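/- Let d ≥ 1 be an integer, K > 0 and 0 < ε ≤ K. Let c : ℝᵈ → ℝᵈ be three times continuously differentiable with |∂^γ c^i(x)| ≤ ε for all x ∈ ℝᵈ, all 1 ≤ i ≤ d and all multi-indices γ with |γ| ≤ 3, and suppose |det(𝕀 + θ·Dc(x))| ≥ K⁻¹ for all x ∈ ℝᵈ and θ ∈ [0,1]. Then there exists a constant N depending only on d and K such that for every twice continuously differentiable, compactly supported function v : ℝᵈ → ℝ one has ∫_{ℝᵈ} [ v(x + c(x)) − v(x) − c(x)·∇v(x) ] dx ≤ N ε² ∫_{ℝᵈ} |v(x)| dx. -/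

import Mathlib

open MeasureTheory Finset
open scoped ENNReal

/-- Partial derivative in direction `i`. -/
noncomputable def pd {d : ℕ} (i : Fin d) (f : EuclideanSpace ℝ (Fin d) → ℝ) :
    EuclideanSpace ℝ (Fin d) → ℝ :=
  fun x => fderiv ℝ f x (EuclideanSpace.single i 1)

/-- Multi-index partial derivative `∂^ζ`. -/
noncomputable def mpd {d : ℕ} (ζ : Fin d → ℕ) (f : EuclideanSpace ℝ (Fin d) → ℝ) :
    EuclideanSpace ℝ (Fin d) → ℝ :=
  (List.finRange d).foldr (fun i g => (pd i)^[ζ i] g) f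

/-- Jacobian matrix of a map `ℝᵈ → ℝᵈ`. -/
noncomputable def jac {d : ℕ} (c : EuclideanSpace ℝ (Fin d) → EuclideanSpace ℝ (Fin d))
    (x : EuclideanSpace ℝ (Fin d)) : Matrix (Fin d) (Fin d) ℝ :=
  Matrix.of fun i j => fderiv ℝ (fun y => c y i) x (EuclideanSpace.single j 1)

/-- The finite set of multi-indices `ζ ∈ ℕᵈ` with `|ζ| ≤ n`. -/
def midx (d n : ℕ) : Finset (Fin d → ℕ) :=
  (Finset.univ.image (fun f : Fin d → Fin (n + 1) => fun i => (f i : ℕ))).filter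
    (fun ζ => ∑ i, ζ i ≤ n)

section PartialDerivatives

variable {d : ℕ} {f g : EuclideanSpace ℝ (Fin d) → ℝ}

theorem ContDiff.pd {n : ℕ} (hf : ContDiff ℝ (n + 1 : ℕ) f) (i : Fin d) :
    ContDiff ℝ n (pd i f) :=
  (hf.fderiv_right (by norm_cast)).clm_apply contDiff_const

theorem HasCompactSupport.pd (hf : HasCompactSupport f) (i : Fin d) :
    HasCompactSupport (pd i f) :=
  hf.fderiv_apply ℝ _

theorem pd_const (i : Fin d) (k : ℝ) :
    pd i (fun _ : EuclideanSpace ℝ (Fin d) => k) = fun _ => 0 := by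
  funext x
  simp [pd]

theorem pd_add (i : Fin d) (hf : Differentiable ℝ f) (hg : Differentiable ℝ g) :
    pd i (fun x => f x + g x) = fun x => pd i f x + pd i g x := by
  funext x
  simp [pd, fderiv_fun_add (hf x) (hg x)]

theorem pd_mul (i : Fin d) (hf : Differentiable ℝ f) (hg : Differentiable ℝ g) :
    pd i (fun x => f x * g x) = fun x => f x * pd i g x + g x * pd i f x := by
  funext x
  simp [pd, fderiv_fun_mul (hf x) (hg x)]

theorem pd_inv (i : Fin d) (hf : Differentiable ℝ f) (h0 : ∀ x, f x ≠ 0) :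
    pd i (fun x => (f x)⁻¹) = fun x => (-1) * (pd i f x * ((f x)⁻¹ * (f x)⁻¹)) := by
  funext x
  have h := ((hasDerivAt_inv (h0 x)).comp_hasFDerivAt x (hf x).hasFDerivAt).fderiv
  have h' : fderiv ℝ (fun x => (f x)⁻¹) x = -(f x ^ 2)⁻¹ • fderiv ℝ f x := h
  simp only [pd, h', smul_apply, smul_eq_mul]
  have := h0 x
  field_simp

/-- `fderiv` in terms of partial derivatives. -/
theorem fderiv_apply_eq_sum_pd (x y : EuclideanSpace ℝ (Fin d)) :
    fderiv ℝ f x y = ∑ i, y i * pd i f x := by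
  have hy : y = ∑ i, y i • EuclideanSpace.single i (1 : ℝ) := by
    ext j
    simp [Finset.sum_apply, Pi.single_apply]
  conv_lhs => rw [hy]
  simp [pd, map_sum]

theorem pd_comm (hf : ContDiff ℝ 2 f) (i j : Fin d) : pd i (pd j f) = pd j (pd i f) := by
  funext x
  have hs : IsSymmSndFDerivAt ℝ f x := hf.contDiffAt.isSymmSndFDerivAt (by simp)
  have hd : DifferentiableAt ℝ (fderiv ℝ f) x :=
    ((hf.fderiv_right (m := 1) (by norm_num)).differentiable (by norm_num)) x
  have key : ∀ a b : Fin d, pd a (pd b f) x =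
      fderiv ℝ (fderiv ℝ f) x (EuclideanSpace.single a 1) (EuclideanSpace.single b 1) := by
    intro a b
    unfold pd
    rw [fderiv_clm_apply hd (differentiableAt_const _)]
    simp
  rw [key, key]
  exact hs _ _

theorem ContDiff.foldr_pd {n : ℕ} (w : List (Fin d)) (hf : ContDiff ℝ (w.length + n : ℕ) f) :
    ContDiff ℝ n (w.foldr _root_.pd f) := by
  induction w generalizing n with
  | nil => simpa using hf
  | cons i w ih =>
    refine ContDiff.pd (ih (n := n + 1) ?_) i
    convert hf using 2
    simp
    ring

/-- Iterated partial derivatives do not depend on the order of differentiation. -/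
theorem List.Perm.foldr_pd_eq {w w' : List (Fin d)} (h : w.Perm w') (hf : ContDiff ℝ w.length f) :
    w.foldr pd f = w'.foldr pd f := by
  induction h with
  | nil => rfl
  | cons i _ ih =>
    rw [List.foldr_cons, List.foldr_cons, ih (hf.of_le (by simp))]
  | swap i j l =>
    simp only [List.foldr_cons]
    refine pd_comm ?_ _ _
    exact ContDiff.foldr_pd (n := 2) l hf
  | trans h₁ _ ih₁ ih₂ => exact (ih₁ hf).trans (ih₂ (by rwa [← h₁.length_eq]))

theorem foldr_replicate_pd (i : Fin d) (n : ℕ) :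
    (List.replicate n i).foldr pd f = (pd i)^[n] f := by
  induction n with
  | zero => rfl
  | succ n ih => rw [List.replicate_succ, List.foldr_cons, ih, Function.iterate_succ_apply']

theorem mpd_eq_foldr_pd (γ : Fin d → ℕ) :
    mpd γ f = ((List.finRange d).flatMap fun i => List.replicate (γ i) i).foldr pd f := by
  unfold mpd
  induction List.finRange d with
  | nil => rfl
  | cons i l ih =>
    rw [List.foldr_cons, ih, List.flatMap_cons, List.foldr_append, foldr_replicate_pd]

/-- Every iterated partial derivative is given by a multi-index. -/
theorem foldr_pd_eq_mpd (w : List (Fin d)) (hf : ContDiff ℝ w.length f) :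
    w.foldr pd f = mpd (fun i => w.count i) f := by
  rw [mpd_eq_foldr_pd]
  refine List.Perm.foldr_pd_eq ?_ hf
  rw [List.perm_iff_count]
  intro a
  rw [List.count_flatMap, ← Fin.sum_univ_def]
  simp [List.count_replicate]

theorem sum_count_eq_length (w : List (Fin d)) : ∑ i, w.count i = w.length := by
  induction w with
  | nil => simp
  | cons a l ih => simp [List.count_cons, Finset.sum_add_distrib, ih]

theorem foldr_pd_const_mul (w : List (Fin d)) (hf : ContDiff ℝ w.length f) (k : ℝ) :
    w.foldr pd (fun x => k * f x) = fun x => k * w.foldr pd f x := by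
  induction w with
  | nil => rfl
  | cons i w ih =>
    have hw : Differentiable ℝ (w.foldr pd f) :=
      (ContDiff.foldr_pd (n := 1) w (by simpa using hf)).differentiable (by norm_num)
    rw [List.foldr_cons, ih (hf.of_le (by simp)), pd_mul i (differentiable_const k) hw, pd_const]
    simp

end PartialDerivatives

section UniformBounds

variable {d : ℕ} {ι : Type*}

/-- A family of `C^n` functions whose partial derivatives up to order `n` are bounded, uniformly
over the family. -/
def UnifBddDeriv (n : ℕ) (f : ι → EuclideanSpace ℝ (Fin d) → ℝ) : Prop :=
  (∀ a, ContDiff ℝ n (f a)) ∧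
    ∀ w : List (Fin d), w.length ≤ n → ∃ M, ∀ a x, |w.foldr pd (f a) x| ≤ M

namespace UnifBddDeriv

variable {n : ℕ} {f g : ι → EuclideanSpace ℝ (Fin d) → ℝ}

theorem bounded (hf : UnifBddDeriv n f) : ∃ M, ∀ a x, |f a x| ≤ M :=
  hf.2 [] (by simp)

theorem differentiable (hf : UnifBddDeriv (n + 1) f) (a : ι) : Differentiable ℝ (f a) :=
  (hf.1 a).differentiable (by norm_cast)

theorem mono {m : ℕ} (hf : UnifBddDeriv n f) (h : m ≤ n) : UnifBddDeriv m f :=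
  ⟨fun a => (hf.1 a).of_le (by exact_mod_cast h), fun w hw => hf.2 w (hw.trans h)⟩

theorem pd (hf : UnifBddDeriv (n + 1) f) (i : Fin d) : UnifBddDeriv n fun a => pd i (f a) := by
  refine ⟨fun a => (hf.1 a).pd i, fun w hw => ?_⟩
  obtain ⟨M, hM⟩ := hf.2 (w ++ [i]) (by simpa using hw)
  exact ⟨M, fun a x => by simpa using hM a x⟩

theorem of_zero (hf : ∀ a, Continuous (f a)) (hb : ∃ M, ∀ a x, |f a x| ≤ M) :
    UnifBddDeriv 0 f := by
  refine ⟨fun a => contDiff_zero.2 (hf a), fun w hw => ?_⟩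
  rw [List.length_eq_zero_iff.1 (Nat.le_zero.1 hw)]
  exact hb

theorem of_succ (hf : ∀ a, ContDiff ℝ (n + 1 : ℕ) (f a)) (hb : ∃ M, ∀ a x, |f a x| ≤ M)
    (hp : ∀ i, UnifBddDeriv n fun a => _root_.pd i (f a)) : UnifBddDeriv (n + 1) f := by
  refine ⟨hf, fun w hw => ?_⟩
  rcases List.eq_nil_or_concat' w with rfl | ⟨w, i, rfl⟩
  · exact hb
  · obtain ⟨M, hM⟩ := (hp i).2 w (by simpa using hw)
    exact ⟨M, fun a x => by simpa using hM a x⟩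

theorem const {k : ι → ℝ} {M : ℝ} (hk : ∀ a, |k a| ≤ M) :
    UnifBddDeriv n fun a (_ : EuclideanSpace ℝ (Fin d)) => k a := by
  induction n generalizing k M with
  | zero => exact of_zero (fun a => continuous_const) ⟨M, fun a _ => hk a⟩
  | succ n ih =>
    refine of_succ (fun a => contDiff_const) ⟨M, fun a _ => hk a⟩ fun i => ?_
    simp only [pd_const]
    exact ih (M := 0) (by simp)

theorem exists_abs_add_le (hf : UnifBddDeriv n f) (hg : UnifBddDeriv n g) :
    ∃ M, ∀ a x, |f a x + g a x| ≤ M := by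
  obtain ⟨M, hM⟩ := hf.bounded
  obtain ⟨M', hM'⟩ := hg.bounded
  exact ⟨M + M', fun a x => (abs_add_le _ _).trans (add_le_add (hM a x) (hM' a x))⟩

theorem exists_abs_mul_le (hf : UnifBddDeriv n f) (hg : UnifBddDeriv n g) :
    ∃ M, ∀ a x, |f a x * g a x| ≤ M := by
  obtain ⟨M, hM⟩ := hf.bounded
  obtain ⟨M', hM'⟩ := hg.bounded
  refine ⟨M * M', fun a x => ?_⟩
  rw [abs_mul]
  exact mul_le_mul (hM a x) (hM' a x) (abs_nonneg _) ((abs_nonneg _).trans (hM a x))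

theorem add (hf : UnifBddDeriv n f) (hg : UnifBddDeriv n g) :
    UnifBddDeriv n fun a x => f a x + g a x := by
  induction n generalizing f g with
  | zero =>
    exact of_zero (fun a => (hf.1 a).continuous.add (hg.1 a).continuous) (hf.exists_abs_add_le hg)
  | succ n ih =>
    refine of_succ (fun a => (hf.1 a).add (hg.1 a)) (hf.exists_abs_add_le hg) fun i => ?_
    simp only [pd_add i (hf.differentiable _) (hg.differentiable _)]
    exact ih (hf.pd i) (hg.pd i)

theorem mul (hf : UnifBddDeriv n f) (hg : UnifBddDeriv n g) :
    UnifBddDeriv n fun a x => f a x * g a x := by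
  induction n generalizing f g with
  | zero =>
    exact of_zero (fun a => (hf.1 a).continuous.mul (hg.1 a).continuous) (hf.exists_abs_mul_le hg)
  | succ n ih =>
    refine of_succ (fun a => (hf.1 a).mul (hg.1 a)) (hf.exists_abs_mul_le hg) fun i => ?_
    simp only [pd_mul i (hf.differentiable _) (hg.differentiable _)]
    exact (ih (hf.mono n.le_succ) (hg.pd i)).add (ih (hg.mono n.le_succ) (hf.pd i))

theorem sum {κ : Type*} (s : Finset κ) {F : κ → ι → EuclideanSpace ℝ (Fin d) → ℝ}
    (hF : ∀ k ∈ s, UnifBddDeriv n (F k)) : UnifBddDeriv n fun a x => ∑ k ∈ s, F k a x := by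
  classical
  induction s using Finset.induction_on with
  | empty => simpa using const (n := n) (k := fun _ : ι => (0 : ℝ)) (M := 0) (by simp)
  | insert k s hk ih =>
    simp only [Finset.sum_insert hk]
    exact (hF k (by simp)).add (ih fun j hj => hF j (by simp [hj]))

theorem prod {κ : Type*} (s : Finset κ) {F : κ → ι → EuclideanSpace ℝ (Fin d) → ℝ}
    (hF : ∀ k ∈ s, UnifBddDeriv n (F k)) : UnifBddDeriv n fun a x => ∏ k ∈ s, F k a x := by
  classical
  induction s using Finset.induction_on with
  | empty => simpa using const (n := n) (k := fun _ : ι => (1 : ℝ)) (M := 1) (by simp)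
  | insert k s hk ih =>
    simp only [Finset.prod_insert hk]
    exact (hF k (by simp)).mul (ih fun j hj => hF j (by simp [hj]))

theorem inv (hf : UnifBddDeriv n f) {δ : ℝ} (hδ : 0 < δ) (h : ∀ a x, δ ≤ |f a x|) :
    UnifBddDeriv n fun a x => (f a x)⁻¹ := by
  have h0 : ∀ a x, f a x ≠ 0 := fun a x => abs_pos.1 (hδ.trans_le (h a x))
  have hb : ∃ M, ∀ a x, |(f a x)⁻¹| ≤ M :=
    ⟨δ⁻¹, fun a x => by rw [abs_inv]; exact inv_anti₀ hδ (h a x)⟩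
  induction n with
  | zero => exact of_zero (fun a => (hf.1 a).continuous.inv₀ (h0 a)) hb
  | succ n ih =>
    refine of_succ (fun a => (hf.1 a).inv (h0 a)) hb fun i => ?_
    simp only [pd_inv i (hf.differentiable _) (h0 _)]
    have hi := ih (hf.mono n.le_succ)
    exact (const (k := fun _ => -1) (M := 1) (by simp)).mul ((hf.pd i).mul (hi.mul hi))

theorem det {m : Type*} [Fintype m] [DecidableEq m]
    {A : ι → EuclideanSpace ℝ (Fin d) → Matrix m m ℝ}
    (hA : ∀ i j, UnifBddDeriv n fun a x => A a x i j) :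
    UnifBddDeriv n fun a x => (A a x).det := by
  simp only [Matrix.det_apply']
  refine sum _ fun σ _ => (const (M := |((Equiv.Perm.sign σ : ℤ) : ℝ)|) fun _ => le_rfl).mul ?_
  exact prod _ fun i _ => hA _ _

theorem matrix_inv {m : Type*} [Fintype m] [DecidableEq m]
    {A : ι → EuclideanSpace ℝ (Fin d) → Matrix m m ℝ}
    (hA : ∀ i j, UnifBddDeriv n fun a x => A a x i j) {δ : ℝ} (hδ : 0 < δ)
    (h : ∀ a x, δ ≤ |(A a x).det|) (i j : m) :
    UnifBddDeriv n fun a x => (A a x)⁻¹ i j := by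
  simp only [Matrix.inv_def, Ring.inverse_eq_inv', Matrix.smul_apply, smul_eq_mul,
    Matrix.adjugate_apply]
  refine ((det hA).inv hδ h).mul (det fun k l => ?_)
  by_cases hk : k = j
  · subst hk
    simp only [Matrix.updateRow_self]
    exact const (M := |(Pi.single i 1 : m → ℝ) l|) fun _ => le_rfl
  · simp only [Matrix.updateRow_ne hk]
    exact hA k l

end UnifBddDeriv

end UniformBounds

section Shift

variable {d : ℕ} {c : EuclideanSpace ℝ (Fin d) → EuclideanSpace ℝ (Fin d)}
  {u b : EuclideanSpace ℝ (Fin d) → ℝ} {R t : ℝ}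

theorem ContDiff.euclidean_apply {n : ℕ} (hc : ContDiff ℝ n c) (i : Fin d) :
    ContDiff ℝ n fun x => c x i :=
  contDiff_euclidean.1 hc i

theorem exists_eq_zero_of_lt_norm (hu : HasCompactSupport u) (hR : ∀ x, ‖c x‖ ≤ R) (T : ℝ) :
    ∃ ρ, ∀ t, |t| ≤ T → ∀ x, ρ < ‖x‖ → u (x + t • c x) = 0 := by
  obtain ⟨r, hr⟩ := hu.isCompact.isBounded.subset_closedBall 0
  refine ⟨r + T * R, fun t ht x hx => ?_⟩
  by_contra h
  have h1 : ‖x + t • c x‖ ≤ r := by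
    simpa using hr (subset_tsupport u h)
  have h2 : ‖t • c x‖ ≤ T * R := by
    rw [norm_smul]
    exact mul_le_mul ht (hR x) (norm_nonneg _) ((abs_nonneg t).trans ht)
  have h3 : ‖x‖ ≤ ‖x + t • c x‖ + ‖t • c x‖ := by
    simpa using norm_sub_le (x + t • c x) (t • c x)
  linarith

theorem HasCompactSupport.comp_shift (hu : HasCompactSupport u) (hR : ∀ x, ‖c x‖ ≤ R) (t : ℝ) :
    HasCompactSupport fun x => u (x + t • c x) := by
  obtain ⟨ρ, hρ⟩ := exists_eq_zero_of_lt_norm hu hR |t|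
  refine HasCompactSupport.intro (isCompact_closedBall 0 ρ) fun x hx => hρ t le_rfl x ?_
  simpa using hx

theorem Continuous.integrable_mul_comp_shift (hb : Continuous b) (hu : Continuous u)
    (hus : HasCompactSupport u) (hc : Continuous c) (hR : ∀ x, ‖c x‖ ≤ R) (t : ℝ) :
    Integrable fun x => b x * u (x + t • c x) :=
  (hb.mul (hu.comp (by fun_prop))).integrable_of_hasCompactSupport
    (HasCompactSupport.mul_left (hus.comp_shift hR t))

theorem pd_comp_shift (hu : Differentiable ℝ u) (hc : Differentiable ℝ c) (t : ℝ) (k : Fin d)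
    (x : EuclideanSpace ℝ (Fin d)) :
    pd k (fun y => u (y + t • c y)) x =
      ∑ i, pd i u (x + t • c x) * ((1 : Matrix (Fin d) (Fin d) ℝ) + t • jac c x) i k := by
  have hφ : HasFDerivAt (fun y => y + t • c y) (ContinuousLinearMap.id ℝ _ + t • fderiv ℝ c x) x :=
    (hasFDerivAt_id x).add ((hc x).hasFDerivAt.const_smul t)
  have h := ((hu (x + t • c x)).hasFDerivAt.comp x hφ).fderiv
  have hci : ∀ i, fderiv ℝ (fun y => c y i) x =
      (EuclideanSpace.proj i : EuclideanSpace ℝ (Fin d) →L[ℝ] ℝ).comp (fderiv ℝ c x) := fun i =>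
    ((EuclideanSpace.proj i : EuclideanSpace ℝ (Fin d) →L[ℝ] ℝ).hasFDerivAt.comp x
      (hc x).hasFDerivAt).fderiv
  have h' : pd k (fun y => u (y + t • c y)) x =
      fderiv ℝ u (x + t • c x) (EuclideanSpace.single k 1 +
        t • fderiv ℝ c x (EuclideanSpace.single k 1)) := by
    unfold pd
    erw [h]
    rfl
  rw [h', fderiv_apply_eq_sum_pd]
  refine Finset.sum_congr rfl fun i _ => ?_
  rw [mul_comm]
  congr 1
  simp [jac, hci, Matrix.one_apply]

/-- The divergence of the vector field `A b`, for a matrix field `A`. -/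
noncomputable def matrixDiv (A : EuclideanSpace ℝ (Fin d) → Matrix (Fin d) (Fin d) ℝ)
    (b : Fin d → EuclideanSpace ℝ (Fin d) → ℝ) (x : EuclideanSpace ℝ (Fin d)) : ℝ :=
  ∑ k, pd k (fun y => ∑ i, A y k i * b i y) x

/-- Integration by parts against a function composed with the shift `x ↦ x + t c(x)`. -/
theorem integral_sum_mul_pd_comp_shift {b : Fin d → EuclideanSpace ℝ (Fin d) → ℝ}
    (hu : ContDiff ℝ 1 u) (hus : HasCompactSupport u) (hc : ContDiff ℝ 1 c)
    (hR : ∀ x, ‖c x‖ ≤ R) (hb : ∀ i, ContDiff ℝ 1 (b i))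
    (hJ : ∀ x, ((1 : Matrix (Fin d) (Fin d) ℝ) + t • jac c x).det ≠ 0)
    (hA : ∀ k i, ContDiff ℝ 1 fun x => ((1 : Matrix (Fin d) (Fin d) ℝ) + t • jac c x)⁻¹ k i) :
    ∫ x, ∑ i, b i x * pd i u (x + t • c x) =
      -∫ x, matrixDiv (fun x => (1 + t • jac c x)⁻¹) b x * u (x + t • c x) := by
  set A := fun x => ((1 : Matrix (Fin d) (Fin d) ℝ) + t • jac c x)⁻¹ with hAdef
  set G := fun (k : Fin d) (y : EuclideanSpace ℝ (Fin d)) => ∑ i, A y k i * b i y with hG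
  set U := fun x => u (x + t • c x) with hU
  have hGd : ∀ k, ContDiff ℝ 1 (G k) := fun k => ContDiff.sum fun i _ => (hA k i).mul (hb i)
  have hUd : ContDiff ℝ 1 U := hu.comp (contDiff_id.add (hc.const_smul t))
  have hUs : HasCompactSupport U := hus.comp_shift hR t
  have hpU : ∀ k, Continuous (pd k U) := fun k =>
    (ContDiff.pd (n := 0) (by simpa using hUd) k).continuous
  have hpG : ∀ k, Continuous (pd k (G k)) := fun k =>
    (ContDiff.pd (n := 0) (by simpa using hGd k) k).continuous
  have hpt : ∀ x, ∑ i, b i x * pd i u (x + t • c x) = ∑ k, G k x * pd k U x := by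
    intro x
    have hmul : (1 + t • jac c x) * A x = 1 :=
      Matrix.mul_nonsing_inv _ (isUnit_iff_ne_zero.2 (hJ x))
    have hvec : dotProduct (Matrix.vecMul (fun l => pd l u (x + t • c x)) (1 + t • jac c x))
        (Matrix.mulVec (A x) fun i => b i x) =
        dotProduct (fun l => pd l u (x + t • c x)) fun i => b i x := by
      rw [Matrix.dotProduct_mulVec, Matrix.vecMul_vecMul, hmul, Matrix.vecMul_one]
    simp only [hU, pd_comp_shift (hu.differentiable one_ne_zero) (hc.differentiable one_ne_zero)]
    simp only [dotProduct, Matrix.vecMul, Matrix.mulVec] at hvec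
    simp only [hG, mul_comm (b _ x), ← hvec]
    exact Finset.sum_congr rfl fun k _ => mul_comm _ _
  have hint : ∀ k, Integrable fun x => G k x * pd k U x := fun k =>
    ((hGd k).continuous.mul (hpU k)).integrable_of_hasCompactSupport
      (HasCompactSupport.mul_left (hUs.pd k))
  have hint' : ∀ k, Integrable fun x => pd k (G k) x * U x := fun k =>
    ((hpG k).mul hUd.continuous).integrable_of_hasCompactSupport (HasCompactSupport.mul_left hUs)
  simp only [hpt, matrixDiv, Finset.sum_mul]
  rw [integral_finsetSum _ fun k _ => hint k, integral_finsetSum _ fun k _ => hint' k,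
    ← Finset.sum_neg_distrib]
  refine Finset.sum_congr rfl fun k _ => ?_
  exact integral_mul_fderiv_eq_neg_fderiv_mul_of_integrable (hint' k) (hint k)
    (((hGd k).continuous.mul hUd.continuous).integrable_of_hasCompactSupport
      (HasCompactSupport.mul_left hUs))
    (fun x _ => (hGd k).differentiable one_ne_zero x)
    (fun x _ => hUd.differentiable one_ne_zero x)

/-- Differentiation of `t ↦ ∫ b(x) u(x + t c(x)) dx`. -/
theorem hasDerivAt_integral_mul_comp_shift (hb : Continuous b) (hu : ContDiff ℝ 1 u)
    (hus : HasCompactSupport u) (hc : Continuous c) (hR : ∀ x, ‖c x‖ ≤ R) (t : ℝ) :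
    HasDerivAt (fun t => ∫ x, b x * u (x + t • c x))
      (∫ x, ∑ i, b x * c x i * pd i u (x + t • c x)) t := by
  set F' := fun (s : ℝ) (x : EuclideanSpace ℝ (Fin d)) =>
    b x * fderiv ℝ u (x + s • c x) (c x) with hF'
  have hfd : Continuous (fderiv ℝ u) := hu.continuous_fderiv one_ne_zero
  have hF'c : Continuous fun p : ℝ × EuclideanSpace ℝ (Fin d) => F' p.1 p.2 := by
    simp only [hF']
    fun_prop
  obtain ⟨ρ, hρ⟩ := exists_eq_zero_of_lt_norm (hus.fderiv ℝ).norm hR (|t| + 1)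
  obtain ⟨M, hM⟩ := ((isCompact_closedBall t 1).prod
    (isCompact_closedBall (0 : EuclideanSpace ℝ (Fin d)) ρ)).exists_bound_of_continuousOn
      hF'c.continuousOn
  have hsum : ∀ x, ∑ i, b x * c x i * pd i u (x + t • c x) = F' t x := fun x => by
    simp only [hF', fderiv_apply_eq_sum_pd, Finset.mul_sum, mul_assoc]
  simp only [hsum]
  refine (hasDerivAt_integral_of_dominated_loc_of_deriv_le (F' := F')
    (bound := (Metric.closedBall 0 ρ).indicator fun _ => M) (Metric.ball_mem_nhds t one_pos)
    (.of_forall fun s => (hb.integrable_mul_comp_shift hu.continuous hus hc hR s).1)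
    (hb.integrable_mul_comp_shift hu.continuous hus hc hR t) ?_ (.of_forall fun x s hs => ?_) ?_
    (.of_forall fun x s _ => ?_)).2
  · exact (hF'c.comp (by fun_prop : Continuous fun x => (t, x))).aestronglyMeasurable
  · by_cases hx : x ∈ Metric.closedBall (0 : EuclideanSpace ℝ (Fin d)) ρ
    · rw [Set.indicator_of_mem hx]
      exact hM (s, x) ⟨Metric.ball_subset_closedBall hs, hx⟩
    · rw [Set.indicator_of_notMem hx]
      have hs' : |s| ≤ |t| + 1 := by
        rw [Metric.mem_ball, Real.dist_eq] at hs
        linarith [abs_sub_abs_le_abs_sub s t]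
      have h0 : fderiv ℝ u (x + s • c x) = 0 := norm_eq_zero.1 (hρ s hs' x (by simpa using hx))
      simp [hF', h0]
  · exact (integrable_indicator_iff measurableSet_closedBall).2
      (integrableOn_const (isCompact_closedBall _ _).measure_lt_top.ne)
  · have hφ : HasDerivAt (fun s : ℝ => x + s • c x) (c x) s := by
      simpa using ((hasDerivAt_id s).smul_const (c x)).const_add x
    exact (((hu.differentiable one_ne_zero _).hasFDerivAt.comp_hasDerivAt s hφ)).const_mul (b x)

end Shift

section ShiftBounds

variable {d : ℕ} {ι : Type*}

/-- A normalised displacement field `c` and a parameter `t` for which the shift `x ↦ x + t c(x)`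
has nondegenerate Jacobian. -/
structure IsNondegenerateShift (K : ℝ)
    (c : EuclideanSpace ℝ (Fin d) → EuclideanSpace ℝ (Fin d)) (t : ℝ) : Prop where
  contDiff : ContDiff ℝ 3 c
  foldr_pd_le : ∀ w : List (Fin d), w.length ≤ 3 → ∀ i x, |w.foldr pd (fun y => c y i) x| ≤ 1
  abs_le : |t| ≤ K
  le_det : ∀ x, K⁻¹ ≤ |((1 : Matrix (Fin d) (Fin d) ℝ) + t • jac c x).det|

theorem UnifBddDeriv.matrixDiv {n : ℕ}
    {A : ι → EuclideanSpace ℝ (Fin d) → Matrix (Fin d) (Fin d) ℝ}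
    {b : Fin d → ι → EuclideanSpace ℝ (Fin d) → ℝ}
    (hA : ∀ k i, UnifBddDeriv (n + 1) fun a x => A a x k i)
    (hb : ∀ i, UnifBddDeriv (n + 1) (b i)) :
    UnifBddDeriv n fun a => matrixDiv (A a) fun i => b i a :=
  UnifBddDeriv.sum _ fun k _ => (UnifBddDeriv.sum _ fun i _ => (hA k i).mul (hb i)).pd k

theorem exists_matrixDiv_bound (d : ℕ) {K : ℝ} (hK : 0 < K) :
    ∃ M, ∀ (c : EuclideanSpace ℝ (Fin d) → EuclideanSpace ℝ (Fin d)) (t : ℝ),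
      IsNondegenerateShift K c t →
      (∀ k i, ContDiff ℝ 1 fun x => ((1 : Matrix (Fin d) (Fin d) ℝ) + t • jac c x)⁻¹ k i) ∧
      (∀ x, |matrixDiv (fun x => (1 + t • jac c x)⁻¹) (fun i y => c y i) x| ≤ M) ∧
      (∀ j, ContDiff ℝ 1
        (matrixDiv (fun x => (1 + t • jac c x)⁻¹) fun i y => c y j * c y i)) ∧
      ∀ x, |matrixDiv (fun x => (1 + t • jac c x)⁻¹) (fun j =>
        matrixDiv (fun x => (1 + t • jac c x)⁻¹) fun i y => c y j * c y i) x| ≤ M := by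
  let ι := {p : (EuclideanSpace ℝ (Fin d) → EuclideanSpace ℝ (Fin d)) × ℝ //
    IsNondegenerateShift K p.1 p.2}
  have hc : ∀ i, UnifBddDeriv 3 fun (a : ι) x => a.1.1 x i := fun i =>
    ⟨fun a => a.2.contDiff.euclidean_apply i, fun w hw => ⟨1, fun a => a.2.foldr_pd_le w hw i⟩⟩
  have hJ : ∀ i j, UnifBddDeriv 2 fun (a : ι) x =>
      ((1 : Matrix (Fin d) (Fin d) ℝ) + a.1.2 • jac a.1.1 x) i j := fun i j =>
    (UnifBddDeriv.const (k := fun _ => (1 : Matrix (Fin d) (Fin d) ℝ) i j)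
      fun _ => le_rfl).add
      ((UnifBddDeriv.const (k := fun a : ι => a.1.2) fun a => a.2.abs_le).mul ((hc i).pd j))
  have hA := UnifBddDeriv.matrix_inv hJ (inv_pos.2 hK) fun a => a.2.le_det
  have hc2 := fun i => (hc i).mono (show 2 ≤ 3 by norm_num)
  have hB := fun j => UnifBddDeriv.matrixDiv hA fun i => (hc2 j).mul (hc2 i)
  have hA1 := fun k i => (hA k i).mono (show 1 ≤ 2 by norm_num)
  obtain ⟨M, hM⟩ := (UnifBddDeriv.matrixDiv hA hc2).bounded
  obtain ⟨M', hM'⟩ := (UnifBddDeriv.matrixDiv hA1 hB).bounded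
  refine ⟨max M M', fun c t h => ⟨fun k i => ?_, fun x => ?_, fun j => ?_, fun x => ?_⟩⟩
  · exact (hA1 k i).1 ⟨(c, t), h⟩
  · exact (hM ⟨(c, t), h⟩ x).trans (le_max_left _ _)
  · exact (hB j).1 ⟨(c, t), h⟩
  · exact (hM' ⟨(c, t), h⟩ x).trans (le_max_right _ _)

theorem IsNondegenerateShift.norm_le {K t : ℝ}
    {c : EuclideanSpace ℝ (Fin d) → EuclideanSpace ℝ (Fin d)} (h : IsNondegenerateShift K c t)
    (x : EuclideanSpace ℝ (Fin d)) : ‖c x‖ ≤ √d := by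
  refine Real.le_sqrt_of_sq_le ?_
  rw [EuclideanSpace.real_norm_sq_eq]
  refine (Finset.sum_le_card_nsmul _ _ 1 fun i _ => ?_).trans_eq (by simp)
  exact (sq_le_one_iff_abs_le_one _).2 (h.foldr_pd_le [] (by simp) i x)

theorem IsNondegenerateShift.det_ne_zero {K t : ℝ} (hK : 0 < K)
    {c : EuclideanSpace ℝ (Fin d) → EuclideanSpace ℝ (Fin d)} (h : IsNondegenerateShift K c t)
    (x : EuclideanSpace ℝ (Fin d)) : ((1 : Matrix (Fin d) (Fin d) ℝ) + t • jac c x).det ≠ 0 :=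
  abs_pos.1 ((inv_pos.2 hK).trans_le (h.le_det x))

section Transport

variable {c : EuclideanSpace ℝ (Fin d) → EuclideanSpace ℝ (Fin d)} {R M T : ℝ}

theorem integral_comp_shift_le_of_nonneg {u : EuclideanSpace ℝ (Fin d) → ℝ}
    (hu : ContDiff ℝ 1 u) (hus : HasCompactSupport u) (hu0 : ∀ x, 0 ≤ u x)
    (hc : ContDiff ℝ 1 c) (hR : ∀ x, ‖c x‖ ≤ R)
    (hJ : ∀ t ∈ Set.Icc 0 T, ∀ x, ((1 : Matrix (Fin d) (Fin d) ℝ) + t • jac c x).det ≠ 0)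
    (hA : ∀ t ∈ Set.Icc 0 T, ∀ k i,
      ContDiff ℝ 1 fun x => ((1 : Matrix (Fin d) (Fin d) ℝ) + t • jac c x)⁻¹ k i)
    (hM : ∀ t ∈ Set.Icc 0 T, ∀ x,
      |matrixDiv (fun x => (1 + t • jac c x)⁻¹) (fun i y => c y i) x| ≤ M)
    {t : ℝ} (ht : t ∈ Set.Icc 0 T) :
    ∫ x, u (x + t • c x) ≤ (∫ x, u x) * Real.exp (M * t) := by
  have hder : ∀ t, HasDerivAt (fun t => ∫ x, u (x + t • c x))
      (∫ x, ∑ i, c x i * pd i u (x + t • c x)) t := fun t => by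
    simpa using hasDerivAt_integral_mul_comp_shift (b := fun _ => 1) continuous_const hu hus
      hc.continuous hR t
  have hint : ∀ t : ℝ, Integrable fun x => u (x + t • c x) := fun t => by
    simpa using continuous_const.integrable_mul_comp_shift (b := fun _ => 1) hu.continuous hus
      hc.continuous hR t
  have key := norm_le_gronwallBound_of_norm_deriv_right_le (f := fun t => ∫ x, u (x + t • c x))
    (a := 0) (b := T) (δ := ∫ x, u x) (K := M) (ε := 0)
    (fun s _ => (hder s).continuousAt.continuousWithinAt) (fun s _ => (hder s).hasDerivWithinAt)
    (by
      simp only [zero_smul, add_zero]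
      exact (Real.norm_of_nonneg (integral_nonneg hu0)).le) (fun s hs => ?_) t ht
  · rw [gronwallBound_ε0, sub_zero] at key
    exact (le_abs_self _).trans key
  · have hs' := Set.Ico_subset_Icc_self hs
    rw [integral_sum_mul_pd_comp_shift hu hus hc hR (fun i => hc.euclidean_apply i) (hJ s hs')
      (hA s hs'), norm_neg, add_zero, Real.norm_of_nonneg (integral_nonneg fun x => hu0 _),
      ← integral_const_mul]
    refine norm_integral_le_of_norm_le ((hint s).const_mul M) (.of_forall fun x => ?_)
    rw [norm_mul, Real.norm_of_nonneg (hu0 _)]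
    exact mul_le_mul_of_nonneg_right (hM s hs' x) (hu0 _)

theorem integral_abs_comp_shift_le {v : EuclideanSpace ℝ (Fin d) → ℝ}
    (hv : ContDiff ℝ 1 v) (hvs : HasCompactSupport v)
    (hc : ContDiff ℝ 1 c) (hR : ∀ x, ‖c x‖ ≤ R)
    (hJ : ∀ t ∈ Set.Icc 0 T, ∀ x, ((1 : Matrix (Fin d) (Fin d) ℝ) + t • jac c x).det ≠ 0)
    (hA : ∀ t ∈ Set.Icc 0 T, ∀ k i,
      ContDiff ℝ 1 fun x => ((1 : Matrix (Fin d) (Fin d) ℝ) + t • jac c x)⁻¹ k i)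
    (hM : ∀ t ∈ Set.Icc 0 T, ∀ x,
      |matrixDiv (fun x => (1 + t • jac c x)⁻¹) (fun i y => c y i) x| ≤ M)
    {t : ℝ} (ht : t ∈ Set.Icc 0 T) :
    ∫ x, |v (x + t • c x)| ≤ (∫ x, |v x|) * Real.exp (M * t) := by
  set S := tsupport fun x => v (x + t • c x) with hS
  have hSc : IsCompact S := hvs.comp_shift hR t
  have hvint : Integrable fun x => |v x| :=
    (hv.continuous.integrable_of_hasCompactSupport hvs).abs
  have hvtint : Integrable fun x => |v (x + t • c x)| := by
    simpa using (continuous_const.integrable_mul_comp_shift (b := fun _ => 1) hv.continuous hvs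
      hc.continuous hR t).abs
  have approx : ∀ δ : ℝ, 0 < δ →
      ∫ x, |v (x + t • c x)| ≤ (∫ x, |v x|) * Real.exp (M * t) + δ * volume.real S := by
    intro δ hδ
    set u := fun x => √(v x ^ 2 + δ ^ 2) - δ with hu
    have hud : ContDiff ℝ 1 u :=
      (((hv.pow 2).add contDiff_const).sqrt fun x => by positivity).sub contDiff_const
    have hus : HasCompactSupport u :=
      hvs.comp_left (g := fun r => √(r ^ 2 + δ ^ 2) - δ) (by simp [Real.sqrt_sq hδ.le])
    have hu0 : ∀ x, 0 ≤ u x := fun x =>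
      sub_nonneg.2 (Real.le_sqrt_of_sq_le (by nlinarith [sq_nonneg (v x)]))
    have huv : ∀ x, u x ≤ |v x| := fun x => by
      refine sub_le_iff_le_add.2 (Real.sqrt_le_iff.2 ⟨by positivity, ?_⟩)
      nlinarith [sq_abs (v x), abs_nonneg (v x)]
    have hvu : ∀ x, |v x| ≤ u x + δ := fun x => by
      simp only [hu, sub_add_cancel]
      exact Real.le_sqrt_of_sq_le (by nlinarith [sq_abs (v x)])
    have huint : Integrable fun x => u (x + t • c x) := by
      simpa using continuous_const.integrable_mul_comp_shift (b := fun _ => 1) hud.continuous hus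
        hc.continuous hR t
    have hind : Integrable (S.indicator fun _ => δ) :=
      (integrable_indicator_iff hSc.measurableSet).2 (integrableOn_const hSc.measure_lt_top.ne)
    calc ∫ x, |v (x + t • c x)| ≤ ∫ x, (u (x + t • c x) + S.indicator (fun _ => δ) x) := by
          refine integral_mono hvtint (huint.add hind) fun x => ?_
          by_cases hx : x ∈ S
          · simpa [hx] using hvu (x + t • c x)
          · have h0 : v (x + t • c x) = 0 :=
              image_eq_zero_of_notMem_tsupport (f := fun x => v (x + t • c x)) hx
            simpa [hx, h0] using hu0 (x + t • c x)
      _ = (∫ x, u (x + t • c x)) + δ * volume.real S := by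
          rw [integral_add huint hind, integral_indicator_const _ hSc.measurableSet, smul_eq_mul,
            mul_comm δ]
      _ ≤ (∫ x, u x) * Real.exp (M * t) + δ * volume.real S := by
          gcongr
          exact integral_comp_shift_le_of_nonneg hud hus hu0 hc hR hJ hA hM ht
      _ ≤ (∫ x, |v x|) * Real.exp (M * t) + δ * volume.real S := by
          refine add_le_add_left (mul_le_mul_of_nonneg_right ?_ (Real.exp_pos _).le) _
          exact integral_mono (hud.continuous.integrable_of_hasCompactSupport hus) hvint huv
  refine le_of_forall_pos_le_add fun η hη => ?_
  have hvol : 0 ≤ volume.real S := measureReal_nonneg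
  refine (approx (η / (volume.real S + 1)) (by positivity)).trans ?_
  gcongr
  rw [div_mul_eq_mul_div, div_le_iff₀ (by positivity)]
  nlinarith

/-- The second-order Taylor remainder of `t ↦ ∫ v(x + t c(x)) dx` is controlled by `∫ |v|`. -/
theorem integral_taylor_shift_le {v : EuclideanSpace ℝ (Fin d) → ℝ}
    (hv : ContDiff ℝ 2 v) (hvs : HasCompactSupport v)
    (hc : ContDiff ℝ 1 c) (hR : ∀ x, ‖c x‖ ≤ R) (hT : 0 ≤ T) (hM0 : 0 ≤ M)
    (hJ : ∀ t ∈ Set.Icc 0 T, ∀ x, ((1 : Matrix (Fin d) (Fin d) ℝ) + t • jac c x).det ≠ 0)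
    (hA : ∀ t ∈ Set.Icc 0 T, ∀ k i,
      ContDiff ℝ 1 fun x => ((1 : Matrix (Fin d) (Fin d) ℝ) + t • jac c x)⁻¹ k i)
    (hM : ∀ t ∈ Set.Icc 0 T, ∀ x,
      |matrixDiv (fun x => (1 + t • jac c x)⁻¹) (fun i y => c y i) x| ≤ M)
    (hB : ∀ t ∈ Set.Icc 0 T, ∀ j, ContDiff ℝ 1
      (matrixDiv (fun x => (1 + t • jac c x)⁻¹) fun i y => c y j * c y i))
    (hM' : ∀ t ∈ Set.Icc 0 T, ∀ x, |matrixDiv (fun x => (1 + t • jac c x)⁻¹) (fun j =>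
      matrixDiv (fun x => (1 + t • jac c x)⁻¹) fun i y => c y j * c y i) x| ≤ M) :
    ∫ x, (v (x + T • c x) - v x - T * ∑ i, c x i * pd i v x) ≤
      M * Real.exp (M * T) * T ^ 2 * ∫ x, |v x| := by
  have hv1 : ContDiff ℝ 1 v := hv.of_le (by norm_num)
  have hpd : ∀ i, ContDiff ℝ 1 (pd i v) := ContDiff.pd hv
  have hpds : ∀ i, HasCompactSupport (pd i v) := hvs.pd
  have hci : ∀ i, ContDiff ℝ 1 fun x => c x i := fun i => hc.euclidean_apply i
  have hint : ∀ (t : ℝ), Integrable fun x => v (x + t • c x) := fun t => by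
    simpa using continuous_const.integrable_mul_comp_shift (b := fun _ => 1) hv.continuous hvs
      hc.continuous hR t
  have hint1 : ∀ (t : ℝ) i, Integrable fun x => c x i * pd i v (x + t • c x) := fun t i =>
    (hci i).continuous.integrable_mul_comp_shift (hpd i).continuous (hpds i) hc.continuous hR t
  have hder : ∀ t, HasDerivAt (fun t => ∫ x, v (x + t • c x))
      (∫ x, ∑ i, c x i * pd i v (x + t • c x)) t := fun t => by
    simpa using hasDerivAt_integral_mul_comp_shift (b := fun _ => 1) continuous_const hv1 hvs
      hc.continuous hR t
  have hder2 : ∀ t, HasDerivAt (fun t => ∫ x, ∑ i, c x i * pd i v (x + t • c x))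
      (∑ i, ∫ x, ∑ j, c x i * c x j * pd j (pd i v) (x + t • c x)) t := fun t => by
    have hswap : (fun t => ∫ x, ∑ i, c x i * pd i v (x + t • c x)) =
        fun t => ∑ i, ∫ x, c x i * pd i v (x + t • c x) :=
      funext fun s => integral_finsetSum _ fun i _ => hint1 s i
    rw [hswap]
    exact HasDerivAt.fun_sum fun i _ => hasDerivAt_integral_mul_comp_shift (hci i).continuous
      (hpd i) (hpds i) hc.continuous hR t
  set V := ∫ x, |v x| with hV
  have hV0 : 0 ≤ V := integral_nonneg fun x => abs_nonneg _
  set C := M * Real.exp (M * T) * V with hC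
  have hC0 : 0 ≤ C := by positivity
  have hbound2 : ∀ t ∈ Set.Icc 0 T,
      ‖∑ i, ∫ x, ∑ j, c x i * c x j * pd j (pd i v) (x + t • c x)‖ ≤ C := by
    intro t ht
    have hB' := fun i => (hB t ht i).continuous.integrable_mul_comp_shift (hpd i).continuous
      (hpds i) hc.continuous hR t
    simp only [integral_sum_mul_pd_comp_shift (hpd _) (hpds _) hc hR
      (fun j => (hci _).mul (hci j)) (hJ t ht) (hA t ht)]
    rw [Finset.sum_neg_distrib, ← integral_finsetSum _ fun i _ => hB' i,
      integral_sum_mul_pd_comp_shift hv1 hvs hc hR (hB t ht) (hJ t ht) (hA t ht), neg_neg]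
    calc _ ≤ ∫ x, M * |v (x + t • c x)| := by
          refine norm_integral_le_of_norm_le ((hint t).abs.const_mul M) (.of_forall fun x => ?_)
          rw [norm_mul]
          exact mul_le_mul_of_nonneg_right (hM' t ht x) (abs_nonneg _)
      _ ≤ M * (V * Real.exp (M * t)) := by
          rw [integral_const_mul]
          gcongr
          exact integral_abs_comp_shift_le hv1 hvs hc hR hJ hA hM ht
      _ ≤ C := by
          have : Real.exp (M * t) ≤ Real.exp (M * T) := by
            gcongr
            exact ht.2
          rw [hC, mul_assoc, mul_comm V]
          gcongr
  have hbound1 : ∀ t ∈ Set.Icc 0 T, ‖(∫ x, ∑ i, c x i * pd i v (x + t • c x)) -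
      ∫ x, ∑ i, c x i * pd i v x‖ ≤ C * T := by
    intro t ht
    have h := norm_image_sub_le_of_norm_deriv_le_segment'
      (fun s (_ : s ∈ Set.Icc 0 T) => (hder2 s).hasDerivWithinAt)
      (fun s hs => hbound2 s (Set.Ico_subset_Icc_self hs)) t ht
    simp only [zero_smul, add_zero, sub_zero] at h
    exact h.trans (by gcongr; exact ht.2)
  set D := ∫ x, ∑ i, c x i * pd i v x with hD
  have h := norm_image_sub_le_of_norm_deriv_le_segment'
    (fun s (_ : s ∈ Set.Icc 0 T) => ((hder s).sub ((hasDerivAt_id s).mul_const D)).hasDerivWithinAt)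
    (fun s hs => by simpa using hbound1 s (Set.Ico_subset_Icc_self hs)) T ⟨hT, le_rfl⟩
  have hint0 : Integrable fun x => ∑ i, c x i * pd i v x := by
    simpa using integrable_finsetSum Finset.univ fun i _ => hint1 0 i
  have hintv : Integrable v := hv.continuous.integrable_of_hasCompactSupport hvs
  have hsplit : ∫ x, (v (x + T • c x) - v x - T * ∑ i, c x i * pd i v x) =
      (∫ x, v (x + T • c x)) - (∫ x, v x) - T * D := by
    rw [integral_sub (f := fun x => v (x + T • c x) - v x) ((hint T).sub hintv)
      (hint0.const_mul T), integral_sub (hint T) hintv, integral_const_mul]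
  rw [hsplit]
  simp only [Pi.sub_apply, id, zero_smul, add_zero, sub_zero, zero_mul] at h
  calc _ = (∫ x, v (x + T • c x)) - T * D - ∫ x, v x := by ring
    _ ≤ C * T * T := (le_abs_self _).trans h
    _ = _ := by rw [hC]; ring

end Transport

end ShiftBounds

/-- There is `N = N(d,K)` such that for any `0 < ε ≤ K`, any `C³` map `c : ℝᵈ → ℝᵈ` with all
partial derivatives up to order `3` bounded by `ε` and `|det(𝕀 + θ·Dc(x))| ≥ K⁻¹`, and any
`C²` compactly supported `v`,
`∫ [v(x + c(x)) − v(x) − c(x)·∇v(x)] dx ≤ N ε² ∫ |v(x)| dx`. -/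
theorem degenerate_SIDE_stmt3 (d : ℕ) (hd : 1 ≤ d) (K : ℝ) (hK : 0 < K) :
    ∃ N : ℝ, ∀ ε : ℝ, 0 < ε → ε ≤ K →
      ∀ c : EuclideanSpace ℝ (Fin d) → EuclideanSpace ℝ (Fin d),
        ContDiff ℝ 3 c →
        (∀ γ : Fin d → ℕ, (∑ i, γ i) ≤ 3 →
          ∀ (i : Fin d) (x : EuclideanSpace ℝ (Fin d)), |mpd γ (fun y => c y i) x| ≤ ε) →
        (∀ (x : EuclideanSpace ℝ (Fin d)), ∀ θ ∈ Set.Icc (0 : ℝ) 1,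
          K⁻¹ ≤ |((1 : Matrix (Fin d) (Fin d) ℝ) + θ • jac c x).det|) →
        ∀ v : EuclideanSpace ℝ (Fin d) → ℝ, ContDiff ℝ 2 v → HasCompactSupport v →
          (∫ x, (v (x + c x) - v x - ∑ i, c x i * pd i v x)) ≤ N * ε ^ 2 * ∫ x, |v x| := by
  obtain ⟨M, hM⟩ := exists_matrixDiv_bound d hK
  refine ⟨max M 0 * Real.exp (max M 0 * K), fun ε hε hεK c hc hbd hdet v hv hvs => ?_⟩
  set c' := fun x => ε⁻¹ • c x with hc'
  have hcd : ContDiff ℝ 3 c' := hc.const_smul ε⁻¹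
  have hjac : ∀ x, jac c' x = ε⁻¹ • jac c x := by
    intro x
    ext i j
    change pd j (fun y => ε⁻¹ * c y i) x = ε⁻¹ * pd j (fun y => c y i) x
    exact congrFun (foldr_pd_const_mul [j]
      ((hc.euclidean_apply (n := 3) i).of_le (by simp)) ε⁻¹) x
  have hnd : ∀ t ∈ Set.Icc 0 ε, IsNondegenerateShift K c' t := by
    intro t ht
    refine ⟨hcd, fun w hw i x => ?_, ?_, fun x => ?_⟩
    · have hci : ContDiff ℝ w.length fun y => c y i :=
        (hc.euclidean_apply (n := 3) i).of_le (by exact_mod_cast hw)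
      have h : |mpd (fun j => w.count j) (fun y => c y i) x| ≤ ε :=
        hbd _ (by rwa [sum_count_eq_length]) i x
      change |w.foldr pd (fun y => ε⁻¹ * c y i) x| ≤ 1
      rw [foldr_pd_const_mul w hci, foldr_pd_eq_mpd w hci, abs_mul, abs_of_pos (inv_pos.2 hε),
        inv_mul_le_iff₀ hε, mul_one]
      exact h
    · rw [abs_of_nonneg ht.1]
      exact ht.2.trans hεK
    · rw [hjac, smul_smul]
      refine hdet x _ ⟨mul_nonneg ht.1 (inv_pos.2 hε).le, ?_⟩
      rw [← div_eq_mul_inv]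
      exact (div_le_one hε).2 ht.2
  have h := integral_taylor_shift_le (T := ε) (M := max M 0) hv hvs (hcd.of_le (by norm_num))
    (hnd 0 ⟨le_rfl, hε.le⟩).norm_le hε.le (le_max_right _ _)
    (fun t ht => (hnd t ht).det_ne_zero hK) (fun t ht => (hM c' t (hnd t ht)).1)
    (fun t ht x => ((hM c' t (hnd t ht)).2.1 x).trans (le_max_left _ _))
    (fun t ht => (hM c' t (hnd t ht)).2.2.1)
    (fun t ht x => ((hM c' t (hnd t ht)).2.2.2 x).trans (le_max_left _ _))
  have heq : ∀ x, v (x + ε • c' x) - v x - ε * ∑ i, c' x i * pd i v x =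
      v (x + c x) - v x - ∑ i, c x i * pd i v x := by
    intro x
    simp [hc', Finset.mul_sum, smul_smul, mul_inv_cancel₀ hε.ne', ← mul_assoc]
  simp only [heq] at h
  refine h.trans ?_
  have hV0 : 0 ≤ ∫ x, |v x| := integral_nonneg fun x => abs_nonneg _
  gcongr
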